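/- Both series Σ_{j=0}^∞ a_j·a_{j+1}·ω_{j+1} and Σ_{j=0}^∞ a_j²·ω_{j+1} converge, and Σ_{j=0}^∞ a_j·a_{j+1}·ω_{j+1} > Σ_{j=0}^∞ a_j²·ω_{j+1}. (Inequality (3.1): |⟨F, zF⟩_ω| > ‖zF‖²_ω, which shows that the zero ζ = ‖zF‖²_ω/⟨F, zF⟩_ω of the first-order optimal polynomial approximant lies in the open unit disk.) -/

import Mathlib

open Finset

/-- The weights `ω_k = (2k choose k)/4^k`. -/
noncomputable def ω : ℕ → ℝ :=
  fun k => (Nat.choose (2 * k) k : ℝ) / 4 ^ k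

/-- Maclaurin coefficients of `F(z) = (1 - √(2/3) z)^(-5/2)`. -/
noncomputable def a : ℕ → ℝ :=
  fun j => ∏ t ∈ Finset.Icc 1 j, (Real.sqrt (2 / 3) * (1 + 3 / (2 * (t : ℝ))))

noncomputable def S₁ : ℝ :=
  Real.sqrt (2 / 3) * ∑ j ∈ Finset.range 25, (1 + 3 / (2 * ((j : ℝ) + 1))) * (a j) ^ 2 * ω (j + 1)

noncomputable def S₂ : ℝ :=
  ∑ j ∈ Finset.range 25, (a j) ^ 2 * ω (j + 1)

noncomputable def S₃ : ℝ :=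
  (5 - Real.sqrt 6) * (a 25) ^ 2 * ω 26

noncomputable def S₄ : ℝ :=
  ∑ j ∈ Finset.range 25, (a j) ^ 2 * ω (j + 1) / ((j : ℝ) + 1)

/-- Rational model of `a j ^ 2 * ω (j+1)`. -/
def qq : ℕ → ℚ
  | 0 => 1 / 2
  | (j + 1) => qq j * ((2 / 3) * (1 + 3 / (2 * ((j : ℚ) + 1))) ^ 2 * ((2 * j + 3) / (2 * j + 4)))

lemma a_succ (j : ℕ) : a (j + 1) = a j * (Real.sqrt (2 / 3) * (1 + 3 / (2 * ((j : ℝ) + 1)))) := by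
  unfold a
  rw [Finset.prod_Icc_succ_top (by omega)]
  push_cast
  rfl

lemma omega_succ (k : ℕ) : ω (k + 1) = ω k * ((2 * k + 1) / (2 * k + 2)) := by
  unfold ω
  have h := Nat.succ_mul_centralBinom_succ k
  rw [Nat.centralBinom_eq_two_mul_choose, Nat.centralBinom_eq_two_mul_choose] at h
  have h' : ((k : ℝ) + 1) * (Nat.choose (2 * (k + 1)) (k + 1) : ℝ)
      = 2 * (2 * k + 1) * (Nat.choose (2 * k) k : ℝ) := by exact_mod_cast h
  have hk : (k : ℝ) + 1 ≠ 0 := by positivity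
  have e : (Nat.choose (2 * (k + 1)) (k + 1) : ℝ)
      = 2 * (2 * k + 1) * (Nat.choose (2 * k) k : ℝ) / (k + 1) := by
    rw [eq_div_iff hk]; linarith
  rw [e, pow_succ]
  field_simp
  ring

lemma qq_eq (j : ℕ) : (a j) ^ 2 * ω (j + 1) = (qq j : ℝ) := by
  induction j with
  | zero => simp [a, ω, qq]; norm_num
  | succ j ih =>
    have hs : Real.sqrt (2 / 3) ^ 2 = 2 / 3 := Real.sq_sqrt (by norm_num)
    rw [omega_succ, a_succ, qq]
    push_cast
    rw [← ih, mul_pow, mul_pow, hs]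
    field_simp
    ring

lemma qq_pos (j : ℕ) : 0 < qq j := by
  induction j with
  | zero => norm_num [qq]
  | succ j ih => rw [qq]; positivity

lemma qq_ratio (j : ℕ) (hj : 20 ≤ j) : qq (j + 1) ≤ 3 / 4 * qq j := by
  rw [qq, mul_comm]
  refine mul_le_mul_of_nonneg_right ?_ (qq_pos j).le
  have hj' : (20 : ℚ) ≤ j := by exact_mod_cast hj
  have h1 : 3 / (2 * ((j : ℚ) + 1)) ≤ 1 / 14 := by
    rw [div_le_div_iff₀ (by positivity) (by norm_num)]; linarith
  obtain ⟨m, rfl⟩ := Nat.exists_eq_add_of_le hj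
  push_cast
  rw [show (2 / 3 * (1 + 3 / (2 * (20 + (m : ℚ) + 1))) ^ 2 *
      ((2 * (20 + (m : ℚ)) + 3) / (2 * (20 + (m : ℚ)) + 4)))
      = (2 * (2 * m + 45) ^ 2 * (2 * m + 43)) / (3 * (2 * m + 42) ^ 2 * (2 * m + 44)) by
    field_simp; ring]
  rw [div_le_iff₀ (by positivity)]
  have : (0 : ℚ) ≤ m := by positivity
  nlinarith [pow_nonneg this 2, pow_nonneg this 3]

lemma qq_num : (0 : ℚ) < ∑ j ∈ range 20, qq j * (816 / 1000 * (1 + 3 / (2 * ((j : ℚ) + 1))) - 1)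
    - 736 / 1000 * qq 20 := by
  simp only [Finset.sum_range_succ, Finset.sum_range_zero, qq]
  norm_num

lemma qq_partial (n : ℕ) :
    (∑ j ∈ range 20, qq j * (816 / 1000 * (1 + 3 / (2 * ((j : ℚ) + 1))) - 1)
    - 736 / 1000 * qq 20) ≤
    ∑ j ∈ range (n + 20), qq j * (816 / 1000 * (1 + 3 / (2 * ((j : ℚ) + 1))) - 1)
    - 736 / 1000 * qq (n + 20) := by
  induction n with
  | zero => simp
  | succ n ih =>
    rw [show n + 1 + 20 = (n + 20) + 1 by ring, Finset.sum_range_succ _ (n + 20)]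
    have h1 := qq_ratio (n + 20) (by omega)
    have h2 := qq_pos (n + 20)
    have h3 : 0 ≤ qq (n + 20) * (3 / (2 * (((n + 20 : ℕ) : ℚ) + 1))) := by positivity
    linarith

/-- Inequality (3.1): `|⟨F, zF⟩_ω| > ‖zF‖²_ω`. -/
theorem inner_product_exceeds_norm :
    Summable (fun j : ℕ => a j * a (j + 1) * ω (j + 1)) ∧
    Summable (fun j : ℕ => (a j) ^ 2 * ω (j + 1)) ∧
    (∑' j : ℕ, a j * a (j + 1) * ω (j + 1)) > ∑' j : ℕ, (a j) ^ 2 * ω (j + 1) := by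
  have hpos : ∀ j, (0 : ℝ) < (qq j : ℝ) := fun j => by exact_mod_cast qq_pos j
  have hs2 : Summable (fun j : ℕ => (a j) ^ 2 * ω (j + 1)) := by
    simp only [qq_eq]
    refine summable_of_ratio_norm_eventually_le (r := 3 / 4) (by norm_num) ?_
    filter_upwards [Filter.eventually_ge_atTop 20] with j hj
    rw [Real.norm_of_nonneg (hpos _).le, Real.norm_of_nonneg (hpos _).le]
    have := qq_ratio j hj
    have h2 : ((qq (j + 1) : ℚ) : ℝ) ≤ ((3 / 4 * qq j : ℚ) : ℝ) := by exact_mod_cast this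
    push_cast at h2
    exact h2
  have hterm : ∀ j, a j * a (j + 1) * ω (j + 1)
      = (qq j : ℝ) * (Real.sqrt (2 / 3) * (1 + 3 / (2 * ((j : ℝ) + 1)))) := by
    intro j
    rw [← qq_eq, a_succ]; ring
  have hc : (816 / 1000 : ℝ) ≤ Real.sqrt (2 / 3) := Real.le_sqrt_of_sq_le (by norm_num)
  have hc1 : Real.sqrt (2 / 3) ≤ 1 := Real.sqrt_le_one.mpr (by norm_num)
  have hs1 : Summable (fun j : ℕ => a j * a (j + 1) * ω (j + 1)) := by
    refine Summable.of_nonneg_of_le (fun j => ?_) (fun j => ?_) (hs2.mul_left 4)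
    · rw [hterm]; have := hpos j; positivity
    · rw [hterm, qq_eq, mul_comm]
      refine mul_le_mul_of_nonneg_right ?_ (hpos j).le
      have h1 : 3 / (2 * ((j : ℝ) + 1)) ≤ 3 := by
        apply div_le_self (by norm_num)
        have : (0 : ℝ) ≤ j := by positivity
        linarith
      have h0 : 0 ≤ 3 / (2 * ((j : ℝ) + 1)) := by positivity
      nlinarith
  refine ⟨hs1, hs2, ?_⟩
  have hd := hs1.sub hs2
  have ht := hd.hasSum.tendsto_sum_nat
  rw [hs1.tsum_sub hs2] at ht
  have hK : (0 : ℝ) < ((∑ j ∈ range 20, qq j * (816 / 1000 * (1 + 3 / (2 * ((j : ℚ) + 1))) - 1)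
    - 736 / 1000 * qq 20 : ℚ) : ℝ) := by exact_mod_cast qq_num
  refine sub_pos.mp (lt_of_lt_of_le hK (ge_of_tendsto ht ?_))
  filter_upwards [Filter.eventually_ge_atTop 20] with n hn
  obtain ⟨m, rfl⟩ := Nat.exists_eq_add_of_le' hn
  have h1 : ((_ : ℚ) : ℝ) ≤ ((_ : ℚ) : ℝ) := Rat.cast_le.mpr (qq_partial m)
  refine h1.trans ?_
  rw [Rat.cast_sub, Rat.cast_sum]
  have h2 : (0 : ℝ) ≤ ((736 / 1000 * qq (m + 20) : ℚ) : ℝ) := by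
    have := qq_pos (m + 20)
    exact_mod_cast (by positivity : (0 : ℚ) ≤ 736 / 1000 * qq (m + 20))
  refine (sub_le_self _ h2).trans (Finset.sum_le_sum fun j _ => ?_)
  rw [hterm, qq_eq]
  push_cast
  have h3 : (816 / 1000 : ℝ) * (1 + 3 / (2 * ((j : ℝ) + 1)))
      ≤ Real.sqrt (2 / 3) * (1 + 3 / (2 * ((j : ℝ) + 1))) :=
    mul_le_mul_of_nonneg_right hc (by positivity)
  have := mul_le_mul_of_nonneg_left h3 (hpos j).le
  linarith
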